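/- For R = ℤ, a = 2, t = 2, M = ℤ/8, N = 2ℤ/8ℤ (the submodule generated by 2), one has 2²·Γ_2(N) = 0 while N ∩ 2²·Γ_2(M) = 4ℤ/8ℤ ≠ 0; hence the functor a^t·Γ_a(−) is not left exact (not hereditary). -/

import Mathlib

open Pointwise

/-- The `a`-torsion submodule `Γ_a(M) = {m | ∃ k ≥ 1, a^k • m = 0}`. -/
def aTorsion (R : Type*) [CommRing R] (a : R) (M : Type*) [AddCommGroup M]
    [Module R M] : Submodule R M :=
  ⨆ k : ℕ, Submodule.torsionBy R M (a ^ (k + 1))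

/-- The generalised locally nilradical `a^t • Γ_a(M)`. -/
def genLocNil (R : Type*) [CommRing R] (a : R) (t : ℕ) (M : Type*)
    [AddCommGroup M] [Module R M] : Submodule R M :=
  a ^ t • aTorsion R a M

theorem aTorsion_eq_top {R : Type*} [CommRing R] {a : R} {M : Type*} [AddCommGroup M]
    [Module R M] (k : ℕ) (h : ∀ m : M, a ^ (k + 1) • m = 0) : aTorsion R a M = ⊤ :=
  top_le_iff.mp fun m _ ↦
    Submodule.mem_iSup_of_mem k ((Submodule.mem_torsionBy_iff _ _).mpr (h m))

theorem mem_genLocNil_iff {R : Type*} [CommRing R] {a : R} {M : Type*} [AddCommGroup M]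
    [Module R M] (k t : ℕ) (h : ∀ m : M, a ^ (k + 1) • m = 0) {x : M} :
    x ∈ genLocNil R a t M ↔ ∃ y : M, a ^ t • y = x := by
  simp [genLocNil, aTorsion_eq_top k h, Submodule.mem_smul_pointwise_iff_exists]

theorem ZMod.two_pow_three_smul_eq_zero (m : ZMod 8) : (2 : ℤ) ^ (2 + 1) • m = 0 := by
  revert m
  decide

/-- for `M = ℤ/8`, `N = 2ℤ/8ℤ`, `a = 2`, `t = 2`, one has
`2² • Γ₂(N) = 0` while `N ⊓ 2² • Γ₂(M) = 4ℤ/8ℤ ≠ 0`; hence `a^t • Γ_a(-)` is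
not hereditary (not left exact). -/
theorem stmt_17 :
    genLocNil ℤ 2 2 (Submodule.span ℤ ({(2 : ZMod 8)} : Set (ZMod 8))) = ⊥ ∧
    Submodule.span ℤ ({(2 : ZMod 8)} : Set (ZMod 8)) ⊓
        genLocNil ℤ 2 2 (ZMod 8) =
      Submodule.span ℤ ({(4 : ZMod 8)} : Set (ZMod 8)) ∧
    Submodule.span ℤ ({(4 : ZMod 8)} : Set (ZMod 8)) ≠ ⊥ := by
  refine ⟨?_, ?_, ?_⟩
  · refine (Submodule.eq_bot_iff _).mpr fun x hx ↦ ?_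
    obtain ⟨⟨y, hy⟩, rfl⟩ := (mem_genLocNil_iff 2 2 fun m ↦
      Subtype.ext (ZMod.two_pow_three_smul_eq_zero m)).mp hx
    obtain ⟨n, rfl⟩ := Submodule.mem_span_singleton.mp hy
    refine Subtype.ext ?_
    change (2 : ℤ) ^ 2 • n • (2 : ZMod 8) = 0
    rw [smul_comm, show (2 : ℤ) ^ 2 • (2 : ZMod 8) = 0 by decide, smul_zero]
  · ext x
    rw [Submodule.mem_inf, mem_genLocNil_iff 2 2 ZMod.two_pow_three_smul_eq_zero]
    simp only [Submodule.mem_span_singleton]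
    constructor
    · rintro ⟨-, y, rfl⟩
      exact ⟨y.val, by revert y; decide⟩
    · rintro ⟨n, rfl⟩
      refine ⟨⟨2 * n, ?_⟩, n • 1, ?_⟩
      · rw [mul_comm, mul_smul, show (2 : ℤ) • (2 : ZMod 8) = 4 by decide]
      · rw [smul_comm, show (2 : ℤ) ^ 2 • (1 : ZMod 8) = 4 by decide]
  · rw [Ne, Submodule.span_singleton_eq_bot]
    decide
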